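/- Let m ≥ 0 and n ≥ 1 be integers and let λ > π be real. Then 1/π = ([∏_{k=1}^{m+n} (2k−1)]² · λ^{2m+1} / ((2m)! · 2^{4m+2n})) · ∫_0^∞ x^{2m} · J_{2m+1}(λx) / (Γ(m+n+1/2+x)·Γ(m+n+1/2−x)) dx. -/

import Mathlib

open MeasureTheory Real

/-- Bessel function of the first kind of nonnegative integer order `n`. -/
noncomputable def besselJ (n : ℕ) (x : ℝ) : ℝ :=
  ∑' k : ℕ, (-1 : ℝ) ^ k / (Nat.factorial k * Nat.factorial (n + k)) * (x / 2) ^ (n + 2 * k)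

/-- The terms of the reduced Bessel series are dominated by those of an exponential series. -/
lemma norm_besselTerm_le (n k : ℕ) (y : ℝ) :
    ‖(-1 : ℝ) ^ k / (Nat.factorial k * Nat.factorial (n + k)) * y ^ k‖
      ≤ |y| ^ k / Nat.factorial k := by
  have h1 : (1 : ℝ) ≤ Nat.factorial (n + k) := by exact_mod_cast Nat.factorial_pos _
  have h2 : (0 : ℝ) < Nat.factorial k := by positivity
  rw [norm_mul, norm_div, norm_pow, norm_neg, norm_one, one_pow, norm_pow, Real.norm_eq_abs y,
    Real.norm_of_nonneg (by positivity), div_mul_eq_mul_div, one_mul]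
  gcongr
  exact le_mul_of_one_le_right h2.le h1

lemma summable_besselTerm (n : ℕ) (y : ℝ) :
    Summable fun k : ℕ ↦ (-1 : ℝ) ^ k / (Nat.factorial k * Nat.factorial (n + k)) * y ^ k :=
  Summable.of_norm_bounded (Real.summable_pow_div_factorial |y|) fun k ↦ norm_besselTerm_le n k y

/-- The entire function `y ↦ y ^ (-n / 2) * J_n (2 * √y)`. -/
noncomputable def besselReduced (n : ℕ) (y : ℝ) : ℝ :=
  ∑' k : ℕ, (-1 : ℝ) ^ k / (Nat.factorial k * Nat.factorial (n + k)) * y ^ k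

lemma besselJ_eq_pow_mul_besselReduced (n : ℕ) (x : ℝ) :
    besselJ n x = (x / 2) ^ n * besselReduced n ((x / 2) ^ 2) := by
  rw [besselJ, besselReduced, ← tsum_mul_left]
  refine tsum_congr fun k ↦ ?_
  rw [pow_add, pow_mul]
  ring

lemma hasDerivAt_besselReduced (n : ℕ) (y : ℝ) :
    HasDerivAt (besselReduced n) (-besselReduced (n + 1) y) y := by
  obtain ⟨R, hR⟩ : ∃ R, |y| < R := exists_gt _
  have hR0 : 0 < R := (abs_nonneg y).trans_lt hR
  have hu : Summable fun k : ℕ ↦ (k : ℝ) * R ^ (k - 1) / Nat.factorial k := by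
    rw [← summable_nat_add_iff 1]
    refine (Real.summable_pow_div_factorial R).congr fun k ↦ ?_
    rw [Nat.factorial_succ]
    push_cast
    field_simp
  have key := hasDerivAt_tsum_of_isPreconnected (𝕜 := ℝ)
    (g := fun (k : ℕ) (y : ℝ) ↦ (-1 : ℝ) ^ k / (Nat.factorial k * Nat.factorial (n + k)) * y ^ k)
    (g' := fun (k : ℕ) (y : ℝ) ↦
      (-1 : ℝ) ^ k / (Nat.factorial k * Nat.factorial (n + k)) * (k * y ^ (k - 1)))
    (t := Metric.ball 0 R) (y₀ := y) (y := y) hu Metric.isOpen_ball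
    (convex_ball _ _).isPreconnected
    (fun k z _ ↦ (hasDerivAt_pow k z).const_mul _)
    (fun k z hz ↦ by
      have hz' : |z| ≤ R := by simpa using (mem_ball_zero_iff.1 hz).le
      have h1 : (1 : ℝ) ≤ Nat.factorial (n + k) := by exact_mod_cast Nat.factorial_pos _
      have h2 : (0 : ℝ) < Nat.factorial k := by positivity
      rw [norm_mul, norm_div, norm_pow, norm_neg, norm_one, one_pow, norm_mul (k : ℝ), norm_pow,
        Real.norm_eq_abs z, Real.norm_natCast, Real.norm_of_nonneg (by positivity),
        div_mul_eq_mul_div, one_mul]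
      gcongr
      exact le_mul_of_one_le_right h2.le h1)
    (by simpa using hR) (summable_besselTerm n y) (by simpa using hR)
  refine HasDerivAt.congr_deriv key ?_
  have hs : Summable fun k : ℕ ↦
      (-1 : ℝ) ^ k / (Nat.factorial k * Nat.factorial (n + k)) * (k * y ^ (k - 1)) := by
    rw [← summable_nat_add_iff 1]
    refine (summable_besselTerm (n + 1) y).neg.congr fun k ↦ ?_
    rw [Nat.factorial_succ, show n + (k + 1) = n + 1 + k by ring, Nat.add_sub_cancel]
    push_cast
    field_simp
    ring
  rw [hs.tsum_eq_zero_add, besselReduced, ← tsum_neg]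
  simp only [Nat.cast_zero, zero_mul, mul_zero, zero_add]
  refine tsum_congr fun k ↦ ?_
  rw [Nat.factorial_succ, show n + (k + 1) = n + 1 + k by ring, Nat.add_sub_cancel]
  push_cast
  field_simp
  ring

lemma continuous_besselJ (n : ℕ) : Continuous (besselJ n) := by
  have h : Continuous (besselReduced n) :=
    continuous_iff_continuousAt.2 fun y ↦ (hasDerivAt_besselReduced n y).continuousAt
  rw [funext (besselJ_eq_pow_mul_besselReduced n)]
  fun_prop

/-- The lowering relation `d/dz (z⁻ⁿ Jₙ(z)) = -z⁻ⁿ Jₙ₊₁(z)`, in the scaling variable. -/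
lemma hasDerivAt_inv_pow_mul_besselJ (n : ℕ) (x : ℝ) {lam : ℝ} (hlam : lam ≠ 0) :
    HasDerivAt (fun l ↦ (l ^ n)⁻¹ * besselJ n (l * x))
      (-(x * ((lam ^ n)⁻¹ * besselJ (n + 1) (lam * x)))) lam := by
  have h1 : HasDerivAt (fun l : ℝ ↦ (x / 2) ^ n * besselReduced n ((l * x / 2) ^ 2))
      ((x / 2) ^ n * (-besselReduced (n + 1) ((lam * x / 2) ^ 2) * (lam * x * x / 2))) lam := by
    refine HasDerivAt.const_mul _ ?_
    refine HasDerivAt.comp (h₂ := besselReduced n) (h := fun l ↦ (l * x / 2) ^ 2) lam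
      (hasDerivAt_besselReduced n ((lam * x / 2) ^ 2)) ?_
    refine ((((hasDerivAt_id' lam).mul_const x).div_const 2).fun_pow 2).congr_deriv ?_
    push_cast
    ring
  have h2 : (fun l ↦ (l ^ n)⁻¹ * besselJ n (l * x))
      =ᶠ[nhds lam] fun l : ℝ ↦ (x / 2) ^ n * besselReduced n ((l * x / 2) ^ 2) := by
    filter_upwards [isOpen_ne.mem_nhds hlam] with l hl
    have hl : l ≠ 0 := hl
    rw [besselJ_eq_pow_mul_besselReduced, mul_div_assoc, mul_pow l]
    field_simp
  refine (h1.congr_of_eventuallyEq h2).congr_deriv ?_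
  rw [besselJ_eq_pow_mul_besselReduced, mul_div_assoc, mul_pow lam _ (n + 1),
    pow_succ lam, pow_succ (x / 2)]
  field_simp

/-- Orthogonality of the exponentials `exp (i j θ)` on `[0, 2π]`. -/
lemma integral_exp_int_mul_I (j : ℤ) :
    ∫ θ in (0 : ℝ)..2 * π, Complex.exp (j * θ * Complex.I) = if j = 0 then 2 * π else 0 := by
  split_ifs with h
  · simp [h]
  · have hc : (j : ℂ) * Complex.I ≠ 0 := by simp [h]
    have := integral_exp_mul_complex (a := 0) (b := 2 * π) hc
    simp only [mul_right_comm _ _ Complex.I]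
    simp only [mul_right_comm _ Complex.I] at this ⊢
    rw [this]
    have h2 : Complex.exp (j * ((2 * π : ℝ) : ℂ) * Complex.I) = 1 := by
      rw [Complex.exp_eq_one_iff]
      exact ⟨j, by push_cast; ring⟩
    rw [h2]
    simp

lemma summable_norm_pow_div_factorial (z : ℂ) :
    Summable fun k : ℕ ↦ ‖z ^ k / (Nat.factorial k : ℂ)‖ := by
  simpa using Real.summable_pow_div_factorial ‖z‖

lemma hasSum_pow_div_factorial (z : ℂ) :
    HasSum (fun k : ℕ ↦ z ^ k / (Nat.factorial k : ℂ)) (Complex.exp z) := by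
  rw [Complex.exp_eq_exp_ℂ]
  exact NormedSpace.expSeries_div_hasSum_exp z

lemma HasSum.mul_prod_of_summable_norm {f g : ℕ → ℂ} {a b : ℂ} (hf : HasSum f a) (hg : HasSum g b)
    (hf' : Summable fun k ↦ ‖f k‖) (hg' : Summable fun k ↦ ‖g k‖) :
    HasSum (fun p : ℕ × ℕ ↦ f p.1 * g p.2) (a * b) :=
  hf.mul hg (summable_mul_of_summable_norm hf' hg')

lemma hasSum_exp_mul_exp (y z : ℂ) :
    HasSum (fun p : ℕ × ℕ ↦ y ^ p.1 / (Nat.factorial p.1 : ℂ) * (z ^ p.2 / (Nat.factorial p.2 : ℂ)))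
      (Complex.exp y * Complex.exp z) := by
  have h := (hasSum_pow_div_factorial y).mul_prod_of_summable_norm (hasSum_pow_div_factorial z)
    (summable_norm_pow_div_factorial y) (summable_norm_pow_div_factorial z)
  exact h

lemma norm_exp_int_mul_I (j : ℤ) (θ : ℝ) : ‖Complex.exp (j * θ * Complex.I)‖ = 1 := by
  exact_mod_cast Complex.norm_exp_ofReal_mul_I (j * θ)

/-- The Laurent expansion of the generating function of the Bessel functions. -/
lemma hasSum_besselGenerating (n : ℕ) (x θ : ℝ) :
    HasSum (fun p : ℕ × ℕ ↦ (-(x / 2) : ℂ) ^ p.1 / (Nat.factorial p.1 : ℂ)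
        * ((x / 2 : ℂ) ^ p.2 / (Nat.factorial p.2 : ℂ))
        * Complex.exp (((n + p.1 - p.2 : ℤ) : ℂ) * θ * Complex.I))
      (Complex.exp (n * θ * Complex.I) * Complex.exp (-(x * Real.sin θ) * Complex.I)) := by
  have hexp : Complex.exp (-(x * Real.sin θ) * Complex.I)
      = Complex.exp (-(x / 2) * Complex.exp (θ * Complex.I))
          * Complex.exp (x / 2 * Complex.exp (-θ * Complex.I)) := by
    rw [← Complex.exp_add, Complex.ofReal_sin, Complex.sin]
    congr 1
    linear_combination (-x * (Complex.exp (-θ * Complex.I) - Complex.exp (θ * Complex.I)) / 2)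
      * Complex.I_sq
  rw [hexp]
  refine ((hasSum_exp_mul_exp _ _).mul_left _).congr_fun fun p ↦ ?_
  have h : Complex.exp (((n + p.1 - p.2 : ℤ) : ℂ) * θ * Complex.I)
      = Complex.exp (n * θ * Complex.I) * Complex.exp (θ * Complex.I) ^ p.1
        * Complex.exp (-θ * Complex.I) ^ p.2 := by
    rw [← Complex.exp_nat_mul, ← Complex.exp_nat_mul, ← Complex.exp_add, ← Complex.exp_add]
    congr 1
    push_cast
    ring
  rw [h, mul_pow, mul_pow]
  ring

/-- Bessel's integral. -/
lemma besselJ_eq_integral (n : ℕ) (x : ℝ) :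
    (besselJ n x : ℂ) = (2 * π : ℂ)⁻¹ * ∫ θ in (0 : ℝ)..2 * π,
      Complex.exp (n * θ * Complex.I) * Complex.exp (-(x * Real.sin θ) * Complex.I) := by
  have hsum := intervalIntegral.hasSum_integral_of_dominated_convergence (μ := volume)
    (a := 0) (b := 2 * π)
    (fun (p : ℕ × ℕ) _ ↦ ‖(-(x / 2) : ℂ) ^ p.1 / (Nat.factorial p.1 : ℂ)
        * ((x / 2 : ℂ) ^ p.2 / (Nat.factorial p.2 : ℂ))‖)
    (fun p ↦ (by fun_prop : Continuous _).aestronglyMeasurable)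
    (fun p ↦ .of_forall fun θ _ ↦ by rw [norm_mul _ (Complex.exp _), norm_exp_int_mul_I, mul_one])
    (.of_forall fun θ _ ↦ (hasSum_exp_mul_exp _ _).summable.norm)
    (by simp) (.of_forall fun θ _ ↦ hasSum_besselGenerating n x θ)
  have hinj : Function.Injective fun k : ℕ ↦ (k, n + k) := fun a b h ↦ congrArg Prod.fst h
  rw [← hinj.hasSum_iff] at hsum
  · have hpi : (2 * π : ℂ) ≠ 0 := by simp [Real.pi_ne_zero]
    rw [← (hsum.mul_left (2 * π : ℂ)⁻¹).tsum_eq, besselJ, Complex.ofReal_tsum]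
    refine tsum_congr fun k ↦ ?_
    simp only [Function.comp]
    rw [intervalIntegral.integral_const_mul, integral_exp_int_mul_I]
    rw [if_pos (by push_cast; ring), neg_pow (x / 2 : ℂ)]
    push_cast
    field_simp
    ring
  · rintro ⟨k, j⟩ hp
    rw [intervalIntegral.integral_const_mul, integral_exp_int_mul_I, if_neg, Complex.ofReal_zero,
      mul_zero]
    contrapose! hp
    refine ⟨k, ?_⟩
    simp only at hp ⊢
    congr 1
    omega

lemma abs_besselJ_le_one (n : ℕ) (x : ℝ) : |besselJ n x| ≤ 1 := by
  have h : ‖∫ θ in (0 : ℝ)..2 * π,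
      Complex.exp (n * θ * Complex.I) * Complex.exp (-(x * Real.sin θ) * Complex.I)‖
        ≤ 1 * |2 * π - 0| := by
    refine intervalIntegral.norm_integral_le_of_norm_le_const fun θ _ ↦ ?_
    have h1 : ‖Complex.exp (n * θ * Complex.I)‖ = 1 := by
      exact_mod_cast Complex.norm_exp_ofReal_mul_I (n * θ)
    have h2 : ‖Complex.exp (-(x * Real.sin θ) * Complex.I)‖ = 1 := by
      exact_mod_cast Complex.norm_exp_ofReal_mul_I (-(x * Real.sin θ))
    rw [norm_mul, h1, h2, one_mul]
  have hpi : 0 < 2 * π := by positivity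
  rw [← Real.norm_eq_abs, ← Complex.norm_real, besselJ_eq_integral, norm_mul, norm_inv]
  rw [one_mul, sub_zero, abs_of_pos hpi] at h
  have hn : ‖(2 * π : ℂ)‖ = 2 * π := by
    exact_mod_cast (Complex.norm_real (2 * π)).trans (Real.norm_of_nonneg hpi.le)
  rw [hn, inv_mul_le_iff₀ hpi, mul_one]
  exact h

lemma norm_lt_norm_of_sq_eq {s r : ℂ} {lam : ℝ} (hs : 0 < s.re) (hr : 0 < r.re)
    (h : r ^ 2 = s ^ 2 + (lam : ℂ) ^ 2) : ‖r - s‖ < ‖r + s‖ := by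
  have him : r.re * r.im = s.re * s.im := by
    have := congrArg Complex.im h
    simp [sq] at this
    linarith
  have hpos : 0 ≤ r.im * s.im := by
    have : 0 ≤ r.re * (r.im * s.im) := by
      rw [← mul_assoc, him]
      nlinarith [mul_nonneg hs.le (sq_nonneg s.im)]
    exact nonneg_of_mul_nonneg_right this hr
  rw [← sq_lt_sq₀ (norm_nonneg _) (norm_nonneg _), ← Complex.normSq_eq_norm_sq,
    ← Complex.normSq_eq_norm_sq, Complex.normSq_apply, Complex.normSq_apply]
  simp only [Complex.sub_re, Complex.sub_im, Complex.add_re, Complex.add_im]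
  nlinarith [mul_pos hs hr]

lemma integral_exp_div_add_sin {s r : ℂ} {lam : ℝ} (hlam : 0 < lam) (hs : 0 < s.re)
    (hr : 0 < r.re) (h : r ^ 2 = s ^ 2 + (lam : ℂ) ^ 2) :
    ∫ θ in (0 : ℝ)..2 * π,
        Complex.exp (θ * Complex.I) * (1 / (s + lam * Real.sin θ * Complex.I))
      = 2 * π * ((1 - s / r) / lam) := by
  have hl : (lam : ℂ) ≠ 0 := by exact_mod_cast hlam.ne'
  have hr0 : r ≠ 0 := by rintro rfl; simp at hr
  have hlt := norm_lt_norm_of_sq_eq hs hr h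
  have hprod : ‖r - s‖ * ‖r + s‖ = lam ^ 2 := by
    rw [← norm_mul, show (r - s) * (r + s) = ((lam ^ 2 : ℝ) : ℂ) by
      push_cast; linear_combination h, Complex.norm_real, Real.norm_of_nonneg (by positivity)]
  have hin : ‖(r - s) / lam‖ < 1 := by
    rw [norm_div, Complex.norm_real, Real.norm_of_nonneg hlam.le, div_lt_one hlam]
    by_contra! hc
    nlinarith [norm_nonneg (r - s)]
  have hout : 1 < ‖-(r + s) / lam‖ := by
    rw [norm_div, norm_neg, Complex.norm_real, Real.norm_of_nonneg hlam.le, one_lt_div hlam]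
    by_contra! hc
    nlinarith [norm_nonneg (r - s)]
  have hne (w : ℂ) (hw : ‖w‖ ≤ 1) : w - -(r + s) / lam ≠ 0 := by
    intro h0
    rw [← sub_eq_zero.1 h0] at hout
    linarith
  have hcauchy := DiffContOnCl.circleIntegral_sub_inv_smul (c := 0) (R := 1) (w := (r - s) / lam)
    (f := fun w : ℂ ↦ 2 * w / (lam * (w - -(r + s) / lam)))
    (DifferentiableOn.diffContOnCl fun w hw ↦ by
      have hw : ‖w‖ ≤ 1 := by
        rw [closure_ball _ one_ne_zero] at hw
        simpa using hw
      have := hne w hw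
      refine DifferentiableAt.differentiableWithinAt ?_
      refine DifferentiableAt.div (by fun_prop) (by fun_prop) (mul_ne_zero hl this))
    (by simpa using hin)
  have hcirc : ∮ w in C(0, 1), (w - (r - s) / lam)⁻¹ • (2 * w / (lam * (w - -(r + s) / lam)))
      = Complex.I * ∫ θ in (0 : ℝ)..2 * π,
        Complex.exp (θ * Complex.I) * (1 / (s + lam * Real.sin θ * Complex.I)) := by
    rw [circleIntegral, ← intervalIntegral.integral_const_mul]
    refine intervalIntegral.integral_congr fun θ _ ↦ ?_
    simp only [deriv_circleMap, circleMap, Complex.ofReal_one, zero_add, one_mul, smul_eq_mul]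
    set w := Complex.exp (θ * Complex.I) with hw
    have hw0 : w ≠ 0 := Complex.exp_ne_zero _
    have hwn : ‖w‖ = 1 := Complex.norm_exp_ofReal_mul_I θ
    have hsin : (Real.sin θ : ℂ) * Complex.I = (w - w⁻¹) / 2 := by
      rw [Complex.ofReal_sin, Complex.sin, hw, ← Complex.exp_neg, neg_mul]
      linear_combination ((Complex.exp (-(θ * Complex.I)) - Complex.exp (θ * Complex.I)) / 2)
        * Complex.I_sq
    have h1 : w - -(r + s) / lam ≠ 0 := hne w hwn.le
    have h2 : w - (r - s) / lam ≠ 0 := by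
      intro h0
      rw [← sub_eq_zero.1 h0] at hin
      linarith
    have h3 : s + lam * ((w - w⁻¹) / 2)
        = lam * (w - (r - s) / lam) * (w - -(r + s) / lam) / (2 * w) := by
      field_simp
      linear_combination h
    rw [mul_assoc (lam : ℂ), hsin, h3]
    generalize w - -(r + s) / lam = u at *
    generalize w - (r - s) / lam = v at *
    field_simp
  rw [hcirc] at hcauchy
  refine mul_left_cancel₀ Complex.I_ne_zero (hcauchy.trans ?_)
  have h4 : (r - s) / lam - -(r + s) / lam = 2 * r / lam := by ring
  rw [h4, smul_eq_mul]
  field_simp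

/-- The Laplace transform of `J₁`. -/
lemma laplace_besselJ_one {s r : ℂ} {lam : ℝ} (hlam : 0 < lam) (hs : 0 < s.re)
    (hr : 0 < r.re) (h : r ^ 2 = s ^ 2 + (lam : ℂ) ^ 2) :
    ∫ x in Set.Ioi (0 : ℝ), Complex.exp (-s * x) * besselJ 1 (lam * x) = (1 - s / r) / lam := by
  let f : ℝ → ℝ → ℂ := fun x θ ↦
    Complex.exp (θ * Complex.I) * Complex.exp (-(s + lam * Real.sin θ * Complex.I) * x)
  have hcont : Continuous (Function.uncurry f) := by
    simp only [f, Function.uncurry_def]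
    fun_prop
  have hre (θ : ℝ) : (s + lam * Real.sin θ * Complex.I).re = s.re := by
    rw [Complex.add_re, ← Complex.ofReal_mul, Complex.re_ofReal_mul]
    simp
  have hnorm (x θ : ℝ) : ‖f x θ‖ = Real.exp (-s.re * x) * 1 := by
    simp only [f]
    rw [norm_mul, Complex.norm_exp_ofReal_mul_I, Complex.norm_exp, Complex.re_mul_ofReal,
      Complex.neg_re, hre, mul_one, one_mul]
  have hint : Integrable (Function.uncurry f) ((volume.restrict (Set.Ioi 0)).prod
      (volume.restrict (Set.Ioc 0 (2 * π)))) := by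
    have h1 : Integrable (fun x : ℝ ↦ Real.exp (-s.re * x)) (volume.restrict (Set.Ioi 0)) :=
      integrableOn_exp_mul_Ioi (by linarith) 0
    have h2 : Integrable (fun _ : ℝ ↦ (1 : ℝ)) (volume.restrict (Set.Ioc 0 (2 * π))) :=
      integrable_const _
    exact (h1.mul_prod h2).mono' hcont.aestronglyMeasurable
      (.of_forall fun p ↦ (hnorm p.1 p.2).le)
  have hswap := integral_integral_swap hint
  have hpi : (2 * π : ℂ) ≠ 0 := by simp [Real.pi_ne_zero]
  have hle : (0 : ℝ) ≤ 2 * π := by positivity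
  have hL (x : ℝ) : Complex.exp (-s * x) * besselJ 1 (lam * x)
      = (2 * π : ℂ)⁻¹ * ∫ θ in Set.Ioc 0 (2 * π), f x θ := by
    rw [besselJ_eq_integral, mul_left_comm, ← intervalIntegral.integral_of_le hle,
      ← intervalIntegral.integral_const_mul]
    congr 1
    refine intervalIntegral.integral_congr fun θ _ ↦ ?_
    simp only [f]
    rw [← Complex.exp_add, ← Complex.exp_add, ← Complex.exp_add]
    congr 1
    push_cast
    ring
  have hR (θ : ℝ) : ∫ x in Set.Ioi (0 : ℝ), f x θ
      = Complex.exp (θ * Complex.I) * (1 / (s + lam * Real.sin θ * Complex.I)) := by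
    simp only [f]
    rw [integral_const_mul, integral_exp_mul_complex_Ioi (by rw [Complex.neg_re, hre]; linarith),
      Complex.ofReal_zero, mul_zero, Complex.exp_zero, neg_div_neg_eq]
  simp_rw [hL, integral_const_mul, hswap, hR]
  rw [← intervalIntegral.integral_of_le hle, integral_exp_div_add_sin hlam hs hr h]
  field_simp

/-- The principal square root of `s² + λ²`. -/
noncomputable def sqrtSqAddSq (lam : ℝ) (s : ℂ) : ℂ := (s ^ 2 + (lam : ℂ) ^ 2) ^ (2⁻¹ : ℂ)

lemma sqrtSqAddSq_sq (lam : ℝ) (s : ℂ) : sqrtSqAddSq lam s ^ 2 = s ^ 2 + (lam : ℂ) ^ 2 :=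
  Complex.cpow_nat_inv_pow _ two_ne_zero

lemma re_sq_add_sq (lam ε t : ℝ) :
    (((ε : ℂ) + t * Complex.I) ^ 2 + (lam : ℂ) ^ 2).re = ε ^ 2 - t ^ 2 + lam ^ 2 := by
  simp [sq]

lemma re_sq_add_sq_pos {lam t : ℝ} (ε : ℝ) (ht : |t| < lam) :
    0 < (((ε : ℂ) + t * Complex.I) ^ 2 + (lam : ℂ) ^ 2).re := by
  rw [re_sq_add_sq]
  have := sq_lt_sq' (abs_lt.1 ht).1 (abs_lt.1 ht).2
  nlinarith [sq_nonneg ε]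

lemma sqrtSqAddSq_re_pos {lam t : ℝ} (ε : ℝ) (ht : |t| < lam) :
    0 < (sqrtSqAddSq lam (ε + t * Complex.I)).re := by
  have h := re_sq_add_sq_pos ε ht
  rw [sqrtSqAddSq, Complex.cpow_inv_two_re]
  exact Real.sqrt_pos.2 (by positivity)

lemma continuousAt_sqrtSqAddSq {lam t : ℝ} (ε : ℝ) (ht : |t| < lam) :
    ContinuousAt (sqrtSqAddSq lam) (ε + t * Complex.I) := by
  refine ContinuousAt.cpow (by fun_prop) continuousAt_const ?_
  exact Or.inl (re_sq_add_sq_pos ε ht)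

/-- The cosine transform of `exp (-ε x) * J₁(λ x)`. -/
lemma integral_exp_mul_besselJ_one_mul_cos {lam t ε : ℝ} (hε : 0 < ε) (ht : |t| < lam) :
    ∫ x in Set.Ioi (0 : ℝ), Real.exp (-ε * x) * besselJ 1 (lam * x) * Real.cos (x * t)
      = ((1 - (ε + t * Complex.I) / sqrtSqAddSq lam (ε + t * Complex.I)) / lam : ℂ).re := by
  have hlam : 0 < lam := (abs_nonneg t).trans_lt ht
  have hs : 0 < ((ε : ℂ) + t * Complex.I).re := by simpa using hε
  rw [← laplace_besselJ_one hlam hs (sqrtSqAddSq_re_pos ε ht) (sqrtSqAddSq_sq lam _)]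
  have hint : Integrable (fun x : ℝ ↦ Complex.exp (-(ε + t * Complex.I) * x)
      * besselJ 1 (lam * x)) (volume.restrict (Set.Ioi 0)) := by
    have hcont : Continuous fun x : ℝ ↦ (besselJ 1 (lam * x) : ℂ) :=
      Complex.continuous_ofReal.comp ((continuous_besselJ 1).comp (by fun_prop))
    refine (integrableOn_exp_mul_complex_Ioi (a := -(ε + t * Complex.I)) (by simpa using hε)
      0).integrable.mul_bdd (c := 1) hcont.aestronglyMeasurable (.of_forall fun x ↦ ?_)
    rw [Complex.norm_real]
    exact abs_besselJ_le_one 1 _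
  have hre := integral_re hint
  simp only [RCLike.re_to_complex] at hre
  rw [← hre]
  refine integral_congr_ae (.of_forall fun x ↦ ?_)
  simp only
  rw [Complex.re_mul_ofReal, Complex.exp_re]
  simp
  ring_nf

lemma tendsto_cosTransform_kernel {lam t : ℝ} (ht : |t| < lam) :
    Filter.Tendsto (fun ε : ℝ ↦
      ((1 - (ε + t * Complex.I) / sqrtSqAddSq lam (ε + t * Complex.I)) / lam : ℂ).re)
      (nhdsWithin 0 (Set.Ioi 0)) (nhds (1 / lam)) := by
  have hlam : 0 < lam := (abs_nonneg t).trans_lt ht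
  have hsq : 0 < lam ^ 2 - t ^ 2 := by
    have := sq_lt_sq' (abs_lt.1 ht).1 (abs_lt.1 ht).2
    linarith
  have hval : sqrtSqAddSq lam ((0 : ℝ) + t * Complex.I) = (Real.sqrt (lam ^ 2 - t ^ 2) : ℂ) := by
    have h1 : (((0 : ℝ) + t * Complex.I) ^ 2 + (lam : ℂ) ^ 2) = ((lam ^ 2 - t ^ 2 : ℝ) : ℂ) := by
      push_cast
      linear_combination (t : ℂ) ^ 2 * Complex.I_sq
    rw [sqrtSqAddSq, h1, Real.sqrt_eq_rpow, Complex.ofReal_cpow hsq.le]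
    norm_num
  have hne : sqrtSqAddSq lam ((0 : ℝ) + t * Complex.I) ≠ 0 := by
    intro h0
    have := sqrtSqAddSq_re_pos 0 ht
    rw [h0] at this
    simp at this
  have hcont : ContinuousAt (fun ε : ℝ ↦
      ((1 - (ε + t * Complex.I) / sqrtSqAddSq lam (ε + t * Complex.I)) / lam : ℂ).re) 0 := by
    have h1 : ContinuousAt (fun ε : ℝ ↦ (ε : ℂ) + t * Complex.I) 0 := by fun_prop
    have h2 : ContinuousAt (fun ε : ℝ ↦ sqrtSqAddSq lam (ε + t * Complex.I)) 0 :=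
      ContinuousAt.comp (g := sqrtSqAddSq lam) (continuousAt_sqrtSqAddSq 0 ht) h1
    exact Complex.continuous_re.continuousAt.comp
      ((continuousAt_const.sub (h1.div h2 hne)).div_const _)
  convert hcont.tendsto.mono_left nhdsWithin_le_nhds using 2
  rw [hval]
  rw [Complex.div_ofReal_re, Complex.sub_re, Complex.div_ofReal_re]
  simp

lemma abs_cosTransform_kernel_le {lam t ε T : ℝ} (hT : T < lam) (ht : |t| ≤ T) (hε : |ε| ≤ 1) :
    |((1 - (ε + t * Complex.I) / sqrtSqAddSq lam (ε + t * Complex.I)) / lam : ℂ).re|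
      ≤ (2 + (1 + T ^ 2) / (lam ^ 2 - T ^ 2)) / lam := by
  have htl : |t| < lam := ht.trans_lt hT
  have hlam : 0 < lam := (abs_nonneg t).trans_lt htl
  have hT0 : 0 ≤ T := (abs_nonneg t).trans ht
  have hd : 0 < lam ^ 2 - T ^ 2 := by nlinarith
  have ht2 : t ^ 2 ≤ T ^ 2 := sq_le_sq' (abs_le.1 ht).1 (abs_le.1 ht).2
  have hε2 : ε ^ 2 ≤ 1 := by nlinarith [abs_le.1 hε]
  set s : ℂ := ε + t * Complex.I with hsdef
  have hs : ‖s‖ ^ 2 ≤ 1 + T ^ 2 := by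
    rw [← Complex.normSq_eq_norm_sq, Complex.normSq_apply]
    simp [hsdef]
    nlinarith
  have hr : lam ^ 2 - T ^ 2 ≤ ‖sqrtSqAddSq lam s‖ ^ 2 := by
    rw [← norm_pow, sqrtSqAddSq_sq]
    refine le_trans ?_ (Complex.re_le_norm _)
    rw [re_sq_add_sq]
    nlinarith [sq_nonneg ε]
  have hq : ‖s / sqrtSqAddSq lam s‖ ≤ 1 + (1 + T ^ 2) / (lam ^ 2 - T ^ 2) := by
    have h1 : ‖s / sqrtSqAddSq lam s‖ ^ 2 ≤ (1 + T ^ 2) / (lam ^ 2 - T ^ 2) := by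
      rw [norm_div, div_pow]
      gcongr
    nlinarith [sq_nonneg (‖s / sqrtSqAddSq lam s‖ - 1), sq_nonneg (‖s / sqrtSqAddSq lam s‖)]
  refine (Complex.abs_re_le_norm _).trans ?_
  rw [norm_div, Complex.norm_real, Real.norm_of_nonneg hlam.le]
  gcongr
  refine (norm_sub_le _ _).trans ?_
  rw [norm_one]
  linarith

/-- Abel regularization of the integral of `J₁(λ x)` against a band-limited function. -/
lemma integral_exp_mul_besselJ_one_mul_cosTransform {φ : ℝ → ℝ} (hφ : Continuous φ)
    {lam T ε : ℝ} (hT0 : 0 ≤ T) (hT : T < lam) (hε : 0 < ε) :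
    ∫ x in Set.Ioi (0 : ℝ), Real.exp (-ε * x)
        * (besselJ 1 (lam * x) * ∫ t in -T..T, φ t * Real.cos (x * t))
      = ∫ t in -T..T, φ t
        * ((1 - (ε + t * Complex.I) / sqrtSqAddSq lam (ε + t * Complex.I)) / lam : ℂ).re := by
  have hle : -T ≤ T := by linarith
  let f : ℝ → ℝ → ℝ := fun x t ↦
    φ t * (Real.exp (-ε * x) * besselJ 1 (lam * x) * Real.cos (x * t))
  have hcont : Continuous (Function.uncurry f) := by
    have := continuous_besselJ 1
    simp only [f, Function.uncurry_def]
    fun_prop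
  have hint : Integrable (Function.uncurry f) ((volume.restrict (Set.Ioi 0)).prod
      (volume.restrict (Set.Ioc (-T) T))) := by
    have h1 : Integrable (fun x : ℝ ↦ Real.exp (-ε * x)) (volume.restrict (Set.Ioi 0)) :=
      integrableOn_exp_mul_Ioi (by linarith) 0
    have h2 : Integrable (fun t : ℝ ↦ |φ t|) (volume.restrict (Set.Ioc (-T) T)) :=
      (hφ.abs.integrableOn_Icc).mono_set Set.Ioc_subset_Icc_self
    refine (h1.mul_prod h2).mono' hcont.aestronglyMeasurable (.of_forall fun p ↦ ?_)
    simp only [f, Function.uncurry_def, norm_mul, Real.norm_eq_abs, Real.abs_exp]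
    have hJ := abs_besselJ_le_one 1 (lam * p.1)
    have hc := Real.abs_cos_le_one (p.1 * p.2)
    calc |φ p.2| * (Real.exp (-ε * p.1) * |besselJ 1 (lam * p.1)| * |Real.cos (p.1 * p.2)|)
        ≤ |φ p.2| * (Real.exp (-ε * p.1) * 1 * 1) := by gcongr
      _ = Real.exp (-ε * p.1) * |φ p.2| := by ring
  have hswap := integral_integral_swap hint
  simp only [f] at hswap
  rw [intervalIntegral.integral_of_le hle]
  simp_rw [intervalIntegral.integral_of_le hle, ← integral_const_mul]
  refine (integral_congr_ae (.of_forall fun x ↦ ?_)).trans (hswap.trans ?_)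
  · refine integral_congr_ae (.of_forall fun t ↦ ?_)
    ring
  · refine setIntegral_congr_fun measurableSet_Ioc fun t ht ↦ ?_
    have htlam : |t| < lam := (abs_le.2 ⟨ht.1.le, ht.2⟩).trans_lt hT
    rw [integral_const_mul, integral_exp_mul_besselJ_one_mul_cos hε htlam]

/-- `J₁(λ ·)` reproduces the value at the origin of functions band-limited to `[-T, T]`, `T < λ`. -/
lemma integral_besselJ_one_mul_cosTransform {φ F : ℝ → ℝ} (hφ : Continuous φ)
    {lam T : ℝ} (hT0 : 0 ≤ T) (hT : T < lam)
    (hF : ∀ x, F x = ∫ t in -T..T, φ t * Real.cos (x * t))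
    (hFint : IntegrableOn F (Set.Ioi 0)) :
    ∫ x in Set.Ioi (0 : ℝ), besselJ 1 (lam * x) * F x = F 0 / lam := by
  have hle : -T ≤ T := by linarith
  have hJF : IntegrableOn (fun x ↦ besselJ 1 (lam * x) * F x) (Set.Ioi 0) := by
    refine hFint.integrable.bdd_mul (c := 1) ?_ (.of_forall fun x ↦ abs_besselJ_le_one 1 _)
    exact ((continuous_besselJ 1).comp (by fun_prop)).aestronglyMeasurable
  have hleft : Filter.Tendsto (fun ε : ℝ ↦ ∫ x in Set.Ioi (0 : ℝ), Real.exp (-ε * x)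
      * (besselJ 1 (lam * x) * F x)) (nhdsWithin 0 (Set.Ioi 0))
      (nhds (∫ x in Set.Ioi (0 : ℝ), besselJ 1 (lam * x) * F x)) := by
    refine tendsto_integral_filter_of_dominated_convergence
      (fun x ↦ ‖besselJ 1 (lam * x) * F x‖) ?_ ?_ hJF.norm ?_
    · refine .of_forall fun ε ↦ AEStronglyMeasurable.mul ?_ hJF.aestronglyMeasurable
      exact (by fun_prop : Continuous fun x ↦ Real.exp (-ε * x)).aestronglyMeasurable
    · filter_upwards [self_mem_nhdsWithin] with ε hε
      refine ae_restrict_of_forall_mem measurableSet_Ioi fun x hx ↦ ?_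
      rw [norm_mul, Real.norm_of_nonneg (Real.exp_pos _).le]
      refine mul_le_of_le_one_left (norm_nonneg _) (Real.exp_le_one_iff.2 ?_)
      have : 0 < ε * x := mul_pos hε hx
      linarith
    · refine .of_forall fun x ↦ ?_
      have : Continuous fun ε : ℝ ↦ Real.exp (-ε * x) * (besselJ 1 (lam * x) * F x) := by fun_prop
      convert this.continuousAt.tendsto.mono_left nhdsWithin_le_nhds using 2
      simp
  have hright : Filter.Tendsto (fun ε : ℝ ↦ ∫ t in -T..T, φ t
        * ((1 - (ε + t * Complex.I) / sqrtSqAddSq lam (ε + t * Complex.I)) / lam : ℂ).re)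
      (nhdsWithin 0 (Set.Ioi 0)) (nhds (∫ t in -T..T, φ t * (1 / lam))) := by
    have habs {t : ℝ} (ht : t ∈ Set.uIoc (-T) T) : |t| ≤ T := by
      rw [Set.uIoc_of_le hle] at ht
      exact abs_le.2 ⟨ht.1.le, ht.2⟩
    refine intervalIntegral.tendsto_integral_filter_of_dominated_convergence
      (fun t ↦ |φ t| * ((2 + (1 + T ^ 2) / (lam ^ 2 - T ^ 2)) / lam)) ?_ ?_ ?_ ?_
    · refine .of_forall fun ε ↦ ContinuousOn.aestronglyMeasurable ?_ measurableSet_uIoc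
      intro t ht
      have ht' := (habs ht).trans_lt hT
      have h1 : ContinuousAt (fun t : ℝ ↦ (ε : ℂ) + t * Complex.I) t := by fun_prop
      have h2 : ContinuousAt (fun t : ℝ ↦ sqrtSqAddSq lam (ε + t * Complex.I)) t :=
        ContinuousAt.comp (g := sqrtSqAddSq lam) (continuousAt_sqrtSqAddSq ε ht') h1
      have hne : sqrtSqAddSq lam (ε + t * Complex.I) ≠ 0 := by
        intro h0
        have := sqrtSqAddSq_re_pos ε ht'
        rw [h0] at this
        simp at this
      exact (hφ.continuousAt.mul (Complex.continuous_re.continuousAt.comp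
        ((continuousAt_const.sub (h1.div h2 hne)).div_const _))).continuousWithinAt
    · filter_upwards [Ioc_mem_nhdsGT (zero_lt_one' ℝ)] with ε hε
      refine .of_forall fun t ht ↦ ?_
      rw [norm_mul, Real.norm_eq_abs, Real.norm_eq_abs]
      gcongr
      exact abs_cosTransform_kernel_le hT (habs ht) (abs_le.2 ⟨by linarith [hε.1], hε.2⟩)
    · exact (by fun_prop : Continuous _).intervalIntegrable _ _
    · exact .of_forall fun t ht ↦
        (tendsto_cosTransform_kernel ((habs ht).trans_lt hT)).const_mul _
  have heq := tendsto_nhds_unique hleft (hright.congr' ?_)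
  · rw [heq, intervalIntegral.integral_mul_const, hF 0]
    simp [div_eq_mul_inv]
  · filter_upwards [self_mem_nhdsWithin] with ε hε
    simp_rw [hF]
    exact (integral_exp_mul_besselJ_one_mul_cosTransform hφ hT0 hT hε).symm

/-- Repeated differentiation in `λ` turns the `J₁` evaluation into those of higher order. -/
lemma integral_pow_mul_besselJ_mul {F : ℝ → ℝ} {c T : ℝ} (hT : 0 < T) {N : ℕ}
    (hint : ∀ k ≤ N, IntegrableOn (fun x ↦ x ^ k * F x) (Set.Ioi 0))
    (hbase : ∀ lam, T < lam → ∫ x in Set.Ioi (0 : ℝ), besselJ 1 (lam * x) * F x = c / lam)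
    {k : ℕ} (hk : k ≤ N) {lam : ℝ} (hlam : T < lam) :
    ∫ x in Set.Ioi (0 : ℝ), besselJ (k + 1) (lam * x) * (x ^ k * F x)
      = c * (2 ^ k * Nat.factorial k) / lam ^ (k + 1) := by
  induction k generalizing lam with
  | zero => simpa using hbase lam hlam
  | succ k ih =>
    have hlam0 : 0 < lam := hT.trans hlam
    have hbint (j l : ℕ) (b : ℝ) (hl : l ≤ N) :
        IntegrableOn (fun x ↦ besselJ j (b * x) * (x ^ l * F x)) (Set.Ioi 0) := by
      refine (hint l hl).integrable.bdd_mul (c := 1) ?_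
        (.of_forall fun x ↦ abs_besselJ_le_one j _)
      exact ((continuous_besselJ j).comp (by fun_prop)).aestronglyMeasurable
    have hderiv := (hasDerivAt_integral_of_dominated_loc_of_deriv_le
      (μ := volume.restrict (Set.Ioi 0)) (x₀ := lam) (s := Set.Ioi T)
      (F := fun b x ↦ (b ^ (k + 1))⁻¹ * besselJ (k + 1) (b * x) * (x ^ k * F x))
      (F' := fun b x ↦ -(x * ((b ^ (k + 1))⁻¹ * besselJ (k + 1 + 1) (b * x))) * (x ^ k * F x))
      (bound := fun x ↦ (T ^ (k + 1))⁻¹ * ‖x ^ (k + 1) * F x‖)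
      (Ioi_mem_nhds hlam)
      (.of_forall fun b ↦ by
        simp only [mul_assoc]
        exact ((hbint _ _ b (by omega)).const_mul _).aestronglyMeasurable)
      (by
        simp only [mul_assoc]
        exact (hbint _ _ lam (by omega)).const_mul _)
      (by
        refine AEStronglyMeasurable.congr (((hbint (k + 1 + 1) (k + 1) lam hk).const_mul
          (-(lam ^ (k + 1))⁻¹)).aestronglyMeasurable) (.of_forall fun x ↦ ?_)
        simp only
        ring)
      (.of_forall fun x b hb ↦ by
        have hb : T < b := hb
        have hb0 : 0 < b := hT.trans hb
        have hJ : ‖besselJ (k + 1 + 1) (b * x)‖ ≤ 1 := abs_besselJ_le_one _ _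
        calc ‖-(x * ((b ^ (k + 1))⁻¹ * besselJ (k + 1 + 1) (b * x))) * (x ^ k * F x)‖
            = (b ^ (k + 1))⁻¹ * ‖besselJ (k + 1 + 1) (b * x)‖ * ‖x ^ (k + 1) * F x‖ := by
              rw [← Real.norm_of_nonneg (by positivity : 0 ≤ (b ^ (k + 1))⁻¹), ← norm_mul,
                ← norm_mul, ← norm_neg]
              congr 1
              rw [Real.norm_of_nonneg (by positivity : 0 ≤ (b ^ (k + 1))⁻¹)]
              ring
          _ ≤ (T ^ (k + 1))⁻¹ * 1 * ‖x ^ (k + 1) * F x‖ := by gcongr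
          _ = _ := by rw [mul_one])
      ((hint (k + 1) hk).norm.const_mul _)
      (.of_forall fun x b hb ↦
        (hasDerivAt_inv_pow_mul_besselJ (k + 1) x (hT.trans hb).ne').mul_const _)).2
    have hexplicit : HasDerivAt (fun b : ℝ ↦ c * (2 ^ k * Nat.factorial k) * (b ^ (2 * k + 2))⁻¹)
        (c * (2 ^ k * Nat.factorial k)
          * (-((2 * k + 2 : ℕ) * lam ^ (2 * k + 1)) / (lam ^ (2 * k + 2)) ^ 2)) lam :=
      ((hasDerivAt_pow (2 * k + 2) lam).fun_inv (by positivity)).const_mul _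
    have hcongr : (fun b : ℝ ↦ c * (2 ^ k * Nat.factorial k) * (b ^ (2 * k + 2))⁻¹)
        =ᶠ[nhds lam] fun b ↦ ∫ x in Set.Ioi (0 : ℝ),
          (b ^ (k + 1))⁻¹ * besselJ (k + 1) (b * x) * (x ^ k * F x) := by
      filter_upwards [Ioi_mem_nhds hlam] with b hb
      have hb0 : 0 < b := hT.trans hb
      simp_rw [mul_assoc (b ^ (k + 1))⁻¹]
      rw [integral_const_mul, ih (by omega) hb]
      field_simp
      ring
    have hunique := (hderiv.congr_of_eventuallyEq hcongr).unique hexplicit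
    have hfinal : ∫ x in Set.Ioi (0 : ℝ),
        -(x * ((lam ^ (k + 1))⁻¹ * besselJ (k + 1 + 1) (lam * x))) * (x ^ k * F x)
        = -(lam ^ (k + 1))⁻¹ * ∫ x in Set.Ioi (0 : ℝ),
          besselJ (k + 1 + 1) (lam * x) * (x ^ (k + 1) * F x) := by
      rw [← integral_const_mul]
      refine integral_congr_ae (.of_forall fun x ↦ ?_)
      simp only
      ring
    rw [hfinal] at hunique
    have hne : -(lam ^ (k + 1))⁻¹ ≠ 0 := neg_ne_zero.2 (by positivity)
    refine mul_left_cancel₀ hne (hunique.trans ?_)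
    rw [Nat.factorial_succ]
    push_cast
    field_simp
    ring

lemma integral_cos_mul_cos_mul_sub_sq {a : ℝ} (ha : Real.cos (a * π) = 0) (x : ℝ) :
    (∫ t in -π..π, Real.cos (a * t) * Real.cos (x * t)) * (a ^ 2 - x ^ 2)
      = 2 * a * Real.sin (a * π) * Real.cos (π * x) := by
  have hd (t : ℝ) : HasDerivAt
      (fun t ↦ a * (Real.sin (a * t) * Real.cos (x * t))
        - x * (Real.cos (a * t) * Real.sin (x * t)))
      (Real.cos (a * t) * Real.cos (x * t) * (a ^ 2 - x ^ 2)) t := by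
    have h1 (b : ℝ) : HasDerivAt (fun t ↦ Real.sin (b * t)) (Real.cos (b * t) * b) t := by
      simpa using ((hasDerivAt_id t).const_mul b).sin
    have h2 (b : ℝ) : HasDerivAt (fun t ↦ Real.cos (b * t)) (-Real.sin (b * t) * b) t := by
      simpa using ((hasDerivAt_id t).const_mul b).cos
    refine ((((h1 a).mul (h2 x)).const_mul a).sub (((h2 a).mul (h1 x)).const_mul x)).congr_deriv ?_
    ring
  rw [← intervalIntegral.integral_mul_const,
    intervalIntegral.integral_eq_sub_of_hasDerivAt (fun t _ ↦ hd t)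
      ((by fun_prop : Continuous _).intervalIntegrable _ _)]
  simp only [mul_neg, Real.sin_neg, Real.cos_neg, ha, mul_comm π x]
  ring

lemma cos_nat_add_half_mul_pi (j : ℕ) : Real.cos (((j : ℝ) + 1 / 2) * π) = 0 := by
  rw [show ((j : ℝ) + 1 / 2) * π = π / 2 + j * π by ring, Real.cos_add_nat_mul_pi]
  simp

/-- Partial fractions: `cos (π x) / (π ∏ ((j + 1/2)² - x²))` is band-limited to `[-π, π]`. -/
lemma exists_cosTransform_eq {p : ℕ} (hp : 0 < p) :
    ∃ φ : ℝ → ℝ, Continuous φ ∧ ∀ x, (∫ t in -π..π, φ t * Real.cos (x * t))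
      * ∏ j ∈ Finset.range p, (((j : ℝ) + 1 / 2) ^ 2 - x ^ 2) = Real.cos (π * x) / π := by
  let a : ℕ → ℝ := fun j ↦ (j : ℝ) + 1 / 2
  have ha (j : ℕ) : 0 < a j := by positivity
  have hcos (j : ℕ) : Real.cos (a j * π) = 0 := cos_nat_add_half_mul_pi j
  have hsin (j : ℕ) : Real.sin (a j * π) ≠ 0 := fun h ↦ by
    have := Real.sin_sq_add_cos_sq (a j * π)
    rw [h, hcos] at this
    norm_num at this
  have hinj : Set.InjOn (fun j ↦ a j ^ 2) (Finset.range p) := by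
    intro i _ j _ hij
    have := (sq_eq_sq₀ (ha i).le (ha j).le).1 hij
    simpa [a] using this
  let d : ℕ → ℝ := fun j ↦ (π * (2 * a j * Real.sin (a j * π)))⁻¹
    * ∏ i ∈ (Finset.range p).erase j, (a j ^ 2 - a i ^ 2)⁻¹ * (-1)
  refine ⟨fun t ↦ ∑ j ∈ Finset.range p, d j * Real.cos (a j * t), by fun_prop, fun x ↦ ?_⟩
  have hlag := congrArg (Polynomial.eval (x ^ 2))
    (Lagrange.sum_basis hinj (Finset.nonempty_range_iff.2 hp.ne'))
  simp only [Lagrange.basis, Lagrange.basisDivisor, Polynomial.eval_finsetSum,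
    Polynomial.eval_prod, Polynomial.eval_mul, Polynomial.eval_C, Polynomial.eval_sub,
    Polynomial.eval_X, Polynomial.eval_one] at hlag
  have hint : ∫ t in -π..π, (∑ j ∈ Finset.range p, d j * Real.cos (a j * t)) * Real.cos (x * t)
      = ∑ j ∈ Finset.range p, d j * ∫ t in -π..π, Real.cos (a j * t) * Real.cos (x * t) := by
    simp_rw [Finset.sum_mul, mul_assoc]
    rw [intervalIntegral.integral_finsetSum fun j _ ↦
      (by fun_prop : Continuous _).intervalIntegrable _ _]
    simp_rw [intervalIntegral.integral_const_mul]
  rw [hint, Finset.sum_mul, div_eq_mul_inv (Real.cos (π * x)),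
    ← mul_one (Real.cos (π * x) * π⁻¹)]
  refine Eq.trans ?_ (congrArg (Real.cos (π * x) * π⁻¹ * ·) hlag)
  simp only [Finset.mul_sum]
  refine Finset.sum_congr rfl fun j hj ↦ ?_
  rw [← Finset.mul_prod_erase _ _ hj]
  have hI := integral_cos_mul_cos_mul_sub_sq (hcos j) x
  have hprod : (∏ i ∈ (Finset.range p).erase j, (a j ^ 2 - a i ^ 2)⁻¹ * (-1))
      * ∏ i ∈ (Finset.range p).erase j, (((i : ℝ) + 1 / 2) ^ 2 - x ^ 2)
      = ∏ i ∈ (Finset.range p).erase j, (a j ^ 2 - a i ^ 2)⁻¹ * (x ^ 2 - a i ^ 2) := by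
    rw [← Finset.prod_mul_distrib]
    refine Finset.prod_congr rfl fun i _ ↦ ?_
    simp only [a]
    ring
  rw [← hprod]
  have hne : 2 * a j * Real.sin (a j * π) ≠ 0 :=
    mul_ne_zero (mul_ne_zero two_ne_zero (ha j).ne') (hsin j)
  have hcancel : (π * (2 * a j * Real.sin (a j * π)))⁻¹
      * ((∫ t in -π..π, Real.cos (a j * t) * Real.cos (x * t)) * (a j ^ 2 - x ^ 2))
      = Real.cos (π * x) * π⁻¹ := by
    rw [hI, mul_inv, mul_assoc, inv_mul_cancel_left₀ hne, mul_comm]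
  rw [← hcancel]
  change (π * (2 * a j * Real.sin (a j * π)))⁻¹
    * (∏ i ∈ (Finset.range p).erase j, (a j ^ 2 - a i ^ 2)⁻¹ * (-1)) * _
    * ((a j ^ 2 - x ^ 2) * _) = _
  ring

/-- The decay of a function with `F x * ∏ ((j + 1/2)² - x²) = cos (π x) / π`. -/
lemma integrableOn_pow_mul_of_mul_prod_eq {F : ℝ → ℝ} (hF : Continuous F) {p k : ℕ}
    (hk : k + 2 ≤ 2 * p)
    (hFp : ∀ x, F x * ∏ j ∈ Finset.range p, (((j : ℝ) + 1 / 2) ^ 2 - x ^ 2)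
      = Real.cos (π * x) / π) :
    IntegrableOn (fun x ↦ x ^ k * F x) (Set.Ioi 0) := by
  have hp : (1 : ℝ) ≤ p := by exact_mod_cast (by omega : 1 ≤ p)
  have hcont : Continuous fun x ↦ x ^ k * F x := by fun_prop
  rw [← Set.Ioc_union_Ioi_eq_Ioi (by positivity : (0 : ℝ) ≤ 2 * p)]
  refine IntegrableOn.union (hcont.integrableOn_Icc.mono_set Set.Ioc_subset_Icc_self) ?_
  have hg : IntegrableOn (fun x : ℝ ↦ 2 ^ p * (2 * (1 + x ^ 2)⁻¹)) (Set.Ioi (2 * p)) :=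
    ((integrable_inv_one_add_sq.const_mul 2).const_mul _).integrableOn
  refine hg.mono' hcont.aestronglyMeasurable
    (ae_restrict_of_forall_mem measurableSet_Ioi fun x hx ↦ ?_)
  have hx : 2 * (p : ℝ) < x := hx
  have hx1 : 1 ≤ x := by linarith
  have hx0 : 0 < x := by linarith
  have hQ : (x ^ 2 / 2) ^ p ≤ |∏ j ∈ Finset.range p, (((j : ℝ) + 1 / 2) ^ 2 - x ^ 2)| := by
    rw [Finset.abs_prod]
    calc (x ^ 2 / 2) ^ p = ∏ _j ∈ Finset.range p, (x ^ 2 / 2) := by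
          rw [Finset.prod_const, Finset.card_range]
      _ ≤ _ := by
        refine Finset.prod_le_prod (fun _ _ ↦ by positivity) fun j hj ↦ ?_
        have hj : (j : ℝ) + 1 ≤ p := by exact_mod_cast Finset.mem_range.1 hj
        have hj0 : (0 : ℝ) ≤ j := by positivity
        rw [abs_sub_comm]
        refine le_trans ?_ (le_abs_self _)
        nlinarith
  have hmul : |F x| * (x ^ 2 / 2) ^ p ≤ 1 := by
    calc |F x| * (x ^ 2 / 2) ^ p
        ≤ |F x| * |∏ j ∈ Finset.range p, (((j : ℝ) + 1 / 2) ^ 2 - x ^ 2)| := by gcongr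
      _ = |Real.cos (π * x)| / π := by
        rw [← abs_mul, hFp, abs_div, abs_of_pos Real.pi_pos]
      _ ≤ 1 := by
        rw [div_le_one Real.pi_pos]
        linarith [Real.abs_cos_le_one (π * x), Real.pi_gt_three]
  have hpow : x ^ k * x ^ 2 ≤ x ^ (2 * p) := by
    rw [← pow_add]
    exact pow_le_pow_right₀ hx1 hk
  have hmul' : |F x| * x ^ (2 * p) ≤ 2 ^ p := by
    rw [div_pow, ← pow_mul, ← mul_div_assoc, div_le_one (by positivity)] at hmul
    exact hmul
  rw [norm_mul, Real.norm_of_nonneg (by positivity), Real.norm_eq_abs]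
  have hb : x ^ k * |F x| * x ^ 2 ≤ 2 ^ p := by
    calc x ^ k * |F x| * x ^ 2 = |F x| * (x ^ k * x ^ 2) := by ring
      _ ≤ |F x| * x ^ (2 * p) := by gcongr
      _ ≤ 2 ^ p := hmul'
  rw [← mul_assoc, ← div_eq_mul_inv, le_div_iff₀ (by positivity)]
  have h0 : x ^ k * |F x| ≤ x ^ k * |F x| * x ^ 2 :=
    le_mul_of_one_le_right (by positivity) (one_le_pow₀ hx1)
  linarith

lemma Gamma_mul_Gamma_half_add_nat (p : ℕ) {x : ℝ} (hx : Real.cos (π * x) ≠ 0) :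
    Real.Gamma (p + 1 / 2 + x) * Real.Gamma (p + 1 / 2 - x)
      = (∏ j ∈ Finset.range p, (((j : ℝ) + 1 / 2) ^ 2 - x ^ 2)) * (π / Real.cos (π * x)) := by
  induction p with
  | zero =>
    have h := Real.Gamma_mul_Gamma_one_sub (1 / 2 + x)
    rw [show π * (1 / 2 + x) = π * x + π / 2 by ring, Real.sin_add_pi_div_two,
      show 1 - (1 / 2 + x) = 1 / 2 - x by ring] at h
    simpa using h
  | succ p ih =>
    have hp : Real.cos (π * (p + 1 / 2)) = 0 := by
      rw [mul_comm]
      exact cos_nat_add_half_mul_pi p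
    have h1 : (p : ℝ) + 1 / 2 + x ≠ 0 := fun h ↦ hx <| by
      rw [show x = -(p + 1 / 2 : ℝ) by linarith, mul_neg, Real.cos_neg, hp]
    have h2 : (p : ℝ) + 1 / 2 - x ≠ 0 := fun h ↦ hx <| by
      rw [show x = (p + 1 / 2 : ℝ) by linarith, hp]
    rw [Finset.prod_range_succ, mul_right_comm, ← ih]
    push_cast
    rw [show (p : ℝ) + 1 + 1 / 2 + x = p + 1 / 2 + x + 1 by ring,
      show (p : ℝ) + 1 + 1 / 2 - x = p + 1 / 2 - x + 1 by ring, Real.Gamma_add_one h1,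
      Real.Gamma_add_one h2]
    ring

lemma ae_cos_pi_mul_ne_zero : ∀ᵐ x : ℝ, Real.cos (π * x) ≠ 0 := by
  have hc : (Set.range fun k : ℤ ↦ (k : ℝ) + 1 / 2).Countable := Set.countable_range _
  filter_upwards [hc.ae_notMem volume] with x hx hcos
  obtain ⟨k, hk⟩ := Real.cos_eq_zero_iff.1 hcos
  refine hx ⟨k, ?_⟩
  have := Real.pi_ne_zero
  field_simp at hk ⊢
  linarith

lemma prod_Icc_two_mul_sub_one (p : ℕ) :
    ∏ k ∈ Finset.Icc 1 p, (2 * (k : ℝ) - 1)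
      = 2 ^ p * ∏ j ∈ Finset.range p, ((j : ℝ) + 1 / 2) := by
  induction p with
  | zero => simp
  | succ p ih =>
    rw [Finset.prod_Icc_succ_top (by omega), ih, Finset.prod_range_succ]
    push_cast
    ring

theorem one_div_pi_identity_odd_order
    (m n : ℕ) (hn : 1 ≤ n) (lam : ℝ) (hlam : π < lam) :
    1 / π = ((∏ k ∈ Finset.Icc 1 (m + n), (2 * (k : ℝ) - 1)) ^ 2 * lam ^ (2 * m + 1)
              / ((Nat.factorial (2 * m) : ℝ) * 2 ^ (4 * m + 2 * n)))
        * ∫ x in Set.Ioi (0 : ℝ), x ^ (2 * m) * besselJ (2 * m + 1) (lam * x)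
            * (Real.Gamma ((m : ℝ) + n + 1 / 2 + x) * Real.Gamma ((m : ℝ) + n + 1 / 2 - x))⁻¹ := by
  obtain ⟨φ, hφ, hφprod⟩ := exists_cosTransform_eq (p := m + n) (by omega)
  obtain ⟨F, hF⟩ : ∃ F : ℝ → ℝ, ∀ x, F x = ∫ t in -π..π, φ t * Real.cos (x * t) :=
    ⟨_, fun _ ↦ rfl⟩
  have hFcont : Continuous F := by
    rw [funext hF]
    exact intervalIntegral.continuous_parametric_intervalIntegral_of_continuous'
      (by fun_prop) _ _
  have hprod (x : ℝ) : F x * ∏ j ∈ Finset.range (m + n), (((j : ℝ) + 1 / 2) ^ 2 - x ^ 2)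
      = Real.cos (π * x) / π := by
    rw [hF, hφprod]
  have hint (k : ℕ) (hk : k ≤ 2 * m) : IntegrableOn (fun x ↦ x ^ k * F x) (Set.Ioi 0) :=
    integrableOn_pow_mul_of_mul_prod_eq hFcont (by omega) hprod
  have hbase (b : ℝ) (hb : π < b) :
      ∫ x in Set.Ioi (0 : ℝ), besselJ 1 (b * x) * F x = F 0 / b :=
    integral_besselJ_one_mul_cosTransform hφ Real.pi_pos.le hb hF
      (by simpa using hint 0 (by omega))
  have hmain := integral_pow_mul_besselJ_mul Real.pi_pos hint hbase le_rfl hlam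
  have hGamma : ∫ x in Set.Ioi (0 : ℝ), x ^ (2 * m) * besselJ (2 * m + 1) (lam * x)
        * (Real.Gamma ((m : ℝ) + n + 1 / 2 + x) * Real.Gamma ((m : ℝ) + n + 1 / 2 - x))⁻¹
      = ∫ x in Set.Ioi (0 : ℝ), besselJ (2 * m + 1) (lam * x) * (x ^ (2 * m) * F x) := by
    refine integral_congr_ae (ae_restrict_of_ae ?_)
    filter_upwards [ae_cos_pi_mul_ne_zero] with x hx
    have hΓ := Gamma_mul_Gamma_half_add_nat (m + n) hx
    push_cast at hΓ
    have hFx := hprod x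
    have hQ : ∏ j ∈ Finset.range (m + n), (((j : ℝ) + 1 / 2) ^ 2 - x ^ 2) ≠ 0 := fun h ↦ by
      rw [h, mul_zero] at hFx
      exact div_ne_zero hx Real.pi_ne_zero hFx.symm
    have hFx' : F x = Real.cos (π * x) / π
        / ∏ j ∈ Finset.range (m + n), (((j : ℝ) + 1 / 2) ^ 2 - x ^ 2) := eq_div_of_mul_eq hQ hFx
    rw [hΓ, hFx']
    generalize ∏ j ∈ Finset.range (m + n), (((j : ℝ) + 1 / 2) ^ 2 - x ^ 2) = Q at hQ
    field_simp
  have hzero : F 0 * (∏ j ∈ Finset.range (m + n), ((j : ℝ) + 1 / 2)) ^ 2 = 1 / π := by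
    have h := hprod 0
    rwa [mul_zero, Real.cos_zero, zero_pow two_ne_zero, Finset.prod_congr rfl
      fun j _ ↦ sub_zero _, Finset.prod_pow] at h
  have hlam0 : lam ≠ 0 := (Real.pi_pos.trans hlam).ne'
  rw [hGamma, hmain, prod_Icc_two_mul_sub_one, ← hzero]
  generalize ∏ j ∈ Finset.range (m + n), ((j : ℝ) + 1 / 2) = P
  field_simp
  ring
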